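/- There exist a constant c > 0 and N ∈ ℕ such that for every multiple n of 3 with n ≥ N the following holds: every polyhedron Q ⊆ ℝ^{E(K_n)} satisfying TSP_n ⊆ Q and such that every (1,3)-uniform comb inequality x(δ(H)) + Σ_{i=1}^{k} x(δ(T_i)) ≥ 3k+1 is valid for all points of Q, has extension complexity xc(Q) ≥ 2^{c·n}. -/

import Mathlib

open SimpleGraph Finset

attribute [local instance] Classical.propDecidable

/-- The edge set of the complete graph `K_n`: non-diagonal unordered pairs. -/
abbrev KEdge (n : ℕ) := {e : Sym2 (Fin n) // ¬ e.IsDiag}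

/-- An edge `e` crosses the vertex set `S` if it has an endpoint in `S`
and an endpoint outside `S`. -/
def crossing {V : Type*} (S : Finset V) (e : Sym2 V) : Prop :=
  (∃ a ∈ e, a ∈ S) ∧ (∃ a ∈ e, a ∉ S)

/-- `x(δ(S))`: the sum of the coordinates of `x` over the edges of `K_n`
crossing `S`. -/
noncomputable def cutSum {n : ℕ} (S : Finset (Fin n)) (x : KEdge n → ℝ) : ℝ :=
  ∑ e ∈ Finset.univ.filter (fun e : KEdge n => crossing S e.1), x e

/-- A comb with handle `H` and teeth `T 0, …, T (k-1)`. -/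
def IsComb {V : Type*} [Fintype V] [DecidableEq V]
    (H : Finset V) {k : ℕ} (T : Fin k → Finset V) : Prop :=
  3 ≤ k ∧ Odd k ∧
  (∀ i j, i ≠ j → Disjoint (T i) (T j)) ∧
  (∀ i, (H ∩ T i).Nonempty) ∧
  (H \ Finset.univ.biUnion T).Nonempty

/-- An `(h,t)`-uniform comb: every tooth has size `t` and meets the handle
in exactly `h` vertices. -/
def IsUniformComb {V : Type*} [Fintype V] [DecidableEq V] (h t : ℕ)
    (H : Finset V) {k : ℕ} (T : Fin k → Finset V) : Prop :=
  IsComb H T ∧ ∀ i, (T i).card = t ∧ (H ∩ T i).card = h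

/-- The extension complexity of `P ⊆ ℝ^ι`: the least number of facets
(inequalities) of a polyhedron `{x : Ax ≤ b}` projecting linearly onto `P`. -/
noncomputable def xc {ι : Type*} [Fintype ι] (P : Set (ι → ℝ)) : ℕ :=
  sInf {k | ∃ (m : ℕ) (A : Matrix (Fin k) (Fin m) ℝ) (b : Fin k → ℝ)
      (π : (Fin m → ℝ) →ₗ[ℝ] (ι → ℝ)),
      π '' {x | A.mulVec x ≤ b} = P}


/-- `P` is a polyhedron if it is the solution set of a finite system of
linear inequalities. -/
def IsPolyhedron {ι : Type*} [Fintype ι] (P : Set (ι → ℝ)) : Prop :=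
  ∃ (k : ℕ) (A : Fin k → ι → ℝ) (b : Fin k → ℝ),
    P = {x | ∀ i, ∑ j, A i j * x j ≤ b i}

/-- The TSP polytope: the convex hull of the characteristic vectors of the
edge sets of the Hamiltonian cycles (tours) of `K_n`. -/
noncomputable def tspPolytope (n : ℕ) : Set (KEdge n → ℝ) :=
  convexHull ℝ {x | ∃ (v : Fin n) (C : (⊤ : SimpleGraph (Fin n)).Walk v v),
    C.IsHamiltonianCycle ∧ x = fun e => if e.1 ∈ C.edges then (1 : ℝ) else 0}


theorem farkas_cone {E : Type*} [AddCommGroup E] [Module ℝ E] :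
    ∀ (k : ℕ) (a : Fin k → E →ₗ[ℝ] ℝ) (l : E →ₗ[ℝ] ℝ),
      (∀ x, (∀ i, a i x ≤ 0) → l x ≤ 0) →
      ∃ c : Fin k → ℝ, (∀ i, 0 ≤ c i) ∧ l = ∑ i, c i • a i := by
  intro k
  induction k with
  | zero =>
    intro a l h
    refine ⟨fun _ => 0, fun i => le_rfl, ?_⟩
    ext x
    have h1 := h x (fun i => i.elim0)
    have h2 := h (-x) (fun i => i.elim0)
    simp only [map_neg] at h2
    simp
    linarith
  | succ k ih =>
    intro a l h
    by_cases hc : ∀ x, (∀ i : Fin k, a i.castSucc x ≤ 0) → l x ≤ 0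
    · obtain ⟨c, hc0, hc1⟩ := ih (fun i => a i.castSucc) l hc
      refine ⟨Fin.snoc (α := fun _ => ℝ) c 0, ?_, ?_⟩
      · intro i
        refine Fin.lastCases ?_ (fun j => ?_) i
        · simp
        · simpa using hc0 j
      · rw [Fin.sum_univ_castSucc]
        simpa using hc1
    · push Not at hc
      obtain ⟨x1, hx1, hl1⟩ := hc
      have hpos : 0 < a (Fin.last k) x1 := by
        by_contra hn
        push Not at hn
        have := h x1 (fun i => Fin.lastCases hn hx1 i)
        linarith
      obtain ⟨x0, hx0, hl0, ha0⟩ : ∃ x0, (∀ i : Fin k, a i.castSucc x0 ≤ 0) ∧ 0 < l x0 ∧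
          a (Fin.last k) x0 = 1 := by
        refine ⟨(a (Fin.last k) x1)⁻¹ • x1, fun i => ?_, ?_, ?_⟩
        · simp only [map_smul, smul_eq_mul]
          exact mul_nonpos_of_nonneg_of_nonpos (by positivity) (hx1 i)
        · simp only [map_smul, smul_eq_mul]
          positivity
        · simp only [map_smul, smul_eq_mul]
          exact inv_mul_cancel₀ hpos.ne'
      obtain ⟨c, hc0, hc1⟩ := ih (fun i => a i.castSucc - (a i.castSucc x0) • a (Fin.last k))
        (l - (l x0) • a (Fin.last k)) (by
          intro x hx
          have := h (x - (a (Fin.last k) x) • x0) (by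
            intro i
            refine Fin.lastCases ?_ (fun j => ?_) i
            · simp [ha0]
            · have := hx j
              simp at this ⊢
              linarith)
          simp at this ⊢
          linarith)
      refine ⟨Fin.snoc (α := fun _ => ℝ) c (l x0 - ∑ i : Fin k, c i * a i.castSucc x0), ?_, ?_⟩
      · intro i
        refine Fin.lastCases ?_ (fun j => ?_) i
        · simp only [Fin.snoc_last]
          have : ∑ i : Fin k, c i * a i.castSucc x0 ≤ 0 :=
            Finset.sum_nonpos (fun i _ => mul_nonpos_of_nonneg_of_nonpos (hc0 i) (hx0 i))
          linarith
        · simpa using hc0 j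
      · rw [Fin.sum_univ_castSucc]
        ext x
        have := LinearMap.congr_fun hc1 x
        simp [mul_sub, Finset.sum_sub_distrib] at this ⊢
        rw [sub_mul, Finset.sum_mul]
        simp only [mul_assoc] at this ⊢
        linarith

theorem farkas_affine {E : Type*} [AddCommGroup E] [Module ℝ E]
    (k : ℕ) (a : Fin k → E →ₗ[ℝ] ℝ) (b : Fin k → ℝ) (l : E →ₗ[ℝ] ℝ) (d : ℝ)
    (hne : ∃ x, ∀ i, a i x ≤ b i)
    (h : ∀ x, (∀ i, a i x ≤ b i) → l x ≤ d) :
    ∃ (c : Fin k → ℝ) (c0 : ℝ), (∀ i, 0 ≤ c i) ∧ 0 ≤ c0 ∧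
      ∀ x, d - l x = ∑ i, c i * (b i - a i x) + c0 := by
  obtain ⟨x0, hx0⟩ := hne
  obtain ⟨c, hc0, hc1⟩ := farkas_cone (E := E × ℝ) (k + 1)
    (Fin.snoc (α := fun _ => E × ℝ →ₗ[ℝ] ℝ)
      (fun i => (a i).comp (LinearMap.fst ℝ E ℝ) - (b i) • LinearMap.snd ℝ E ℝ)
      (- LinearMap.snd ℝ E ℝ))
    (l.comp (LinearMap.fst ℝ E ℝ) - d • LinearMap.snd ℝ E ℝ) (by
      rintro ⟨x, t⟩ hx
      have ht : 0 ≤ t := by simpa using hx (Fin.last k)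
      have hi : ∀ i : Fin k, a i x ≤ b i * t := by
        intro i
        have := hx i.castSucc
        simp at this
        linarith
      simp
      rcases ht.eq_or_lt with rfl | ht
      · simp at hi ⊢
        by_contra hl
        push Not at hl
        have key : ∀ s : ℝ, 0 ≤ s → l x0 + s * l x ≤ d := by
          intro s hs
          have := h (x0 + s • x) (fun i => by
            have := mul_nonpos_of_nonneg_of_nonpos hs (hi i)
            have := hx0 i
            simp; linarith)
          simpa using this
        have h0 := h x0 hx0
        have := key ((d - l x0 + 1) / l x) (by apply div_nonneg <;> linarith)
        rw [div_mul_cancel₀ _ hl.ne'] at this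
        linarith
      · have := h (t⁻¹ • x) (fun i => by
          simp only [map_smul, smul_eq_mul]
          rw [inv_mul_le_iff₀ ht]; linarith [hi i])
        simp only [map_smul, smul_eq_mul] at this
        rw [inv_mul_le_iff₀ ht] at this
        linarith)
  refine ⟨fun i => c i.castSucc, c (Fin.last k), fun i => hc0 _, hc0 _, fun x => ?_⟩
  have := LinearMap.congr_fun hc1 (x, 1)
  simp [Fin.sum_univ_castSucc] at this
  have h2 : ∑ i : Fin k, c i.castSucc * (b i - a i x)
      = - ∑ i : Fin k, c i.castSucc * (a i x - b i) := by
    rw [← Finset.sum_neg_distrib]; congr 1; ext i; ring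
  rw [h2]; linarith


theorem level_one_aux {ι : Type*} [Fintype ι] [DecidableEq ι]
    (F : (ι → Bool) → ℝ) (h0 : ∀ z, 0 ≤ F z) (h1 : ∀ z, F z ≤ 1) (hA : 0 < ∑ z, F z)
    (a : ι → ℝ) (ha : ∀ s, a s * ∑ z, F z = ∑ z, F z * (if z s then 1 else -1)) :
    Real.exp ((∑ s, a s ^ 2) / 2) * ∑ z, F z ≤ 2 ^ Fintype.card ι := by
  set A := ∑ z, F z with hAdef
  set B := ∑ s, a s ^ 2 with hB
  let L : (ι → Bool) → ℝ := fun z => ∑ s, a s * (if z s then 1 else -1)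
  have hJ : Real.exp (∑ z, (F z / A) • L z) ≤ ∑ z, (F z / A) • Real.exp (L z) :=
    convexOn_exp.map_sum_le (fun z _ => div_nonneg (h0 z) hA.le)
      (by rw [← Finset.sum_div]; exact div_self hA.ne') (fun z _ => Set.mem_univ _)
  have hL : ∑ z, (F z / A) • L z = B := by
    simp only [L, smul_eq_mul, Finset.mul_sum]
    rw [Finset.sum_comm]
    apply Finset.sum_congr rfl
    intro s _
    have : ∑ z, F z / A * (a s * (if z s then 1 else -1))
        = a s / A * ∑ z, F z * (if z s then 1 else -1) := by
      rw [Finset.mul_sum]; apply Finset.sum_congr rfl; intro z _; ring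
    rw [this, ← ha]
    field_simp
  have hE : ∑ z : ι → Bool, Real.exp (L z) ≤ 2 ^ Fintype.card ι * Real.exp (B / 2) := by
    have e1 : ∑ z : ι → Bool, Real.exp (L z)
        = ∏ s : ι, ∑ b : Bool, Real.exp (a s * (if b then 1 else -1)) := by
      rw [Finset.prod_univ_sum, Fintype.piFinset_univ]
      apply Finset.sum_congr rfl
      intro z _
      simp only [L]
      rw [Real.exp_sum]
    rw [e1]
    calc _ ≤ ∏ s : ι, (2 * Real.exp (a s ^ 2 / 2)) := by
          apply Finset.prod_le_prod
          · intro s _; positivity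
          · intro s _
            have := Real.cosh_le_exp_half_sq (a s)
            rw [Real.cosh_eq] at this
            simp
            linarith
      _ = _ := by
          rw [Finset.prod_mul_distrib, ← Real.exp_sum, ← Finset.sum_div]
          simp [Finset.card_univ, hB]
  have hF : ∑ z, (F z / A) • Real.exp (L z) ≤ (∑ z : ι → Bool, Real.exp (L z)) / A := by
    rw [Finset.sum_div]
    apply Finset.sum_le_sum
    intro z _
    rw [smul_eq_mul, div_mul_eq_mul_div]
    gcongr
    have := Real.exp_pos (L z)
    nlinarith [h1 z]
  rw [hL] at hJ
  have h3 : Real.exp B * A ≤ 2 ^ Fintype.card ι * Real.exp (B / 2) := by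
    have := (hJ.trans hF)
    rw [le_div_iff₀ hA] at this
    exact this.trans hE
  have h4 : Real.exp B = Real.exp (B/2) * Real.exp (B/2) := by rw [← Real.exp_add]; ring_nf
  rw [h4] at h3
  have := Real.exp_pos (B/2)
  nlinarith

theorem level_one {ι : Type*} [Fintype ι] [DecidableEq ι]
    (F : (ι → Bool) → ℝ) (h0 : ∀ z, 0 ≤ F z) (h1 : ∀ z, F z ≤ 1) (F0 F1 : ι → ℝ)
    (hF0 : ∀ s, F0 s = ∑ z, if z s = false then F z else 0)
    (hF1 : ∀ s, F1 s = ∑ z, if z s = true then F z else 0) :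
    ∑ s, (if 1.05 * F1 s < F0 s then F0 s else 0) ≤
      Fintype.card ι * (0.005 * ∑ z, F z +
        2 ^ Fintype.card ι * Real.exp (-0.000001 * Fintype.card ι)) := by
  set A := ∑ z, F z with hAdef
  set N := Fintype.card ι with hN
  have hsum : ∀ s, F0 s + F1 s = A := by
    intro s
    rw [hF0, hF1, ← Finset.sum_add_distrib]
    apply Finset.sum_congr rfl
    intro z _
    cases z s <;> simp
  have hF0n : ∀ s, 0 ≤ F0 s := fun s => by
    rw [hF0]; exact Finset.sum_nonneg (fun z _ => by split_ifs <;> simp [h0])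
  have hF1n : ∀ s, 0 ≤ F1 s := fun s => by
    rw [hF1]; exact Finset.sum_nonneg (fun z _ => by split_ifs <;> simp [h0])
  have hA0 : 0 ≤ A := Finset.sum_nonneg (fun z _ => h0 z)
  have hexp := Real.exp_pos (-0.000001 * (N:ℝ))
  by_cases hc : A ≤ 2 ^ N * Real.exp (-0.000001 * N)
  · calc _ ≤ ∑ s : ι, A := by
          apply Finset.sum_le_sum
          intro s _
          have := hsum s; have := hF1n s
          split_ifs <;> linarith
      _ = N * A := by simp [hN, Finset.card_univ]
      _ ≤ _ := by
          gcongr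
          linarith
  · push Not at hc
    have hApos : 0 < A := lt_of_le_of_lt (by positivity) hc
    have hlev := level_one_aux F h0 h1 hApos (fun s => (F1 s - F0 s) / A) (by
      intro s
      rw [← hAdef, div_mul_cancel₀ _ hApos.ne', hF0, hF1, ← Finset.sum_sub_distrib]
      apply Finset.sum_congr rfl
      intro z _
      cases z s <;> simp)
    set B := ∑ s, ((F1 s - F0 s) / A) ^ 2 with hB
    have hB2 : B ≤ 0.000002 * N := by
      by_contra hcon
      push Not at hcon
      have e1 : Real.exp (0.000001 * N) ≤ Real.exp (B / 2) := by
        apply Real.exp_le_exp.mpr; linarith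
      have e2 : Real.exp (0.000001 * N) * Real.exp (-0.000001 * N) = 1 := by
        rw [← Real.exp_add]; ring_nf; exact Real.exp_zero
      have e3 := Real.exp_pos (0.000001 * (N:ℝ))
      have : (2:ℝ) ^ N < Real.exp (B/2) * A := by
        calc (2:ℝ) ^ N = Real.exp (0.000001 * N) * (2 ^ N * Real.exp (-0.000001 * N)) := by
              linear_combination (- (2:ℝ)^N) * e2
          _ < Real.exp (0.000001 * N) * A := by gcongr
          _ ≤ _ := by gcongr
      linarith
    calc _ ≤ ∑ s : ι, 2500 * A * ((F1 s - F0 s) / A) ^ 2 := by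
          apply Finset.sum_le_sum
          intro s _
          split_ifs with hb
          · have hs := hsum s
            have : 1 ≤ 2500 * ((F1 s - F0 s) / A) ^ 2 := by
              rw [div_pow, mul_div_assoc', le_div_iff₀ (by positivity), ← hs]
              have := hF0n s; have := hF1n s
              nlinarith
            have := hF0n s; have := hF1n s
            nlinarith
          · positivity
      _ = 2500 * A * B := (Finset.mul_sum _ _ _).symm
      _ ≤ 2500 * A * (0.000002 * N) := by gcongr
      _ ≤ _ := by
          have : 0 ≤ (N:ℝ) * (2 ^ N * Real.exp (-0.000001 * N)) := by positivity
          nlinarith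


/-! template -/
abbrev TV (m : ℕ) := (Fin 5 × Bool) ⊕ ((Fin m × Bool) ⊕ (Fin m × (Bool × Bool)))

instance instDecTV (m : ℕ) : DecidableEq (TV m) := inferInstance

instance instFinTV (m : ℕ) : Fintype (TV m) := inferInstance

instance instFinPermTV (m : ℕ) : Fintype (Equiv.Perm (TV m)) := inferInstance

def tokU (c : Bool) : Fin 5 × Bool → Bool
  | (j, b) => !b && (if j = 0 ∨ j = 1 then c else true)

def tokM (c : Bool) : Fin 5 × Bool → Fin 5 × Bool
  | (j, b) => if j = 0 ∨ j = 1 then (if c then (j, !b) else (1 - j, b)) else (j, !b)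

def uu {m : ℕ} (z : Option (Fin m) → Bool) : TV m → Bool
  | Sum.inl p => tokU (z none) p
  | Sum.inr (Sum.inl (i, _)) => z (some i)
  | Sum.inr (Sum.inr _) => false

def MMf {m : ℕ} (y : Option (Fin m) → Bool) : TV m → TV m
  | Sum.inl p => Sum.inl (tokM (y none) p)
  | Sum.inr (Sum.inl (i, b)) => Sum.inr (Sum.inl (i, !b))
  | Sum.inr (Sum.inr (i, (c, d))) =>
      Sum.inr (Sum.inr (i, if y (some i) then (c, !d) else (!c, d)))

theorem tokM_invol : ∀ c p, tokM c (tokM c p) = p := by decide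
theorem tokM_ne : ∀ c p, tokM c p ≠ p := by decide

theorem MMf_invol {m : ℕ} (y : Option (Fin m) → Bool) : Function.Involutive (MMf y) := by
  rintro (p | ⟨i, b⟩ | ⟨i, c, d⟩)
  · simp [MMf, tokM_invol]
  · simp [MMf]
  · cases h : y (some i) <;> simp [MMf, h]

theorem MMf_ne {m : ℕ} (y : Option (Fin m) → Bool) : ∀ v, MMf y v ≠ v := by
  rintro (p | ⟨i, b⟩ | ⟨i, c, d⟩)
  · simp [MMf, tokM_ne]
  · simp [MMf]
  · cases h : y (some i) <;> simp [MMf, h]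

def MM {m : ℕ} (y : Option (Fin m) → Bool) : Equiv.Perm (TV m) := (MMf_invol y).toPerm

@[simp] theorem MM_apply {m : ℕ} (y : Option (Fin m) → Bool) (v) : MM y v = MMf y v := rfl

def sAf {m : ℕ} (i : Fin m) : TV m → TV m
  | Sum.inl (j, b) => if b = false ∧ j = 0 then Sum.inr (Sum.inl (i, false)) else
      if b = false ∧ j = 1 then Sum.inr (Sum.inl (i, true)) else Sum.inl (j, b)
  | Sum.inr (Sum.inl (i', b)) =>
      if i' = i then Sum.inl (if b then 1 else 0, false) else Sum.inr (Sum.inl (i', b))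
  | Sum.inr (Sum.inr q) => Sum.inr (Sum.inr q)

def sBf {m : ℕ} (i : Fin m) : TV m → TV m
  | Sum.inl (j, b) => if j = 0 then Sum.inr (Sum.inr (i, (false, b))) else
      if j = 1 then Sum.inr (Sum.inr (i, (true, b))) else Sum.inl (j, b)
  | Sum.inr (Sum.inl q) => Sum.inr (Sum.inl q)
  | Sum.inr (Sum.inr (i', (c, d))) =>
      if i' = i then Sum.inl (if c then 1 else 0, d) else Sum.inr (Sum.inr (i', (c, d)))

theorem sAf_invol {m : ℕ} (i : Fin m) : Function.Involutive (sAf i) := by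
  rintro (⟨j, b⟩ | ⟨i', b⟩ | ⟨i', c, d⟩)
  · fin_cases j <;> cases b <;> simp [sAf]
  · by_cases h : i' = i <;> cases b <;> simp [sAf, h]
  · simp [sAf]

theorem sBf_invol {m : ℕ} (i : Fin m) : Function.Involutive (sBf i) := by
  rintro (⟨j, b⟩ | ⟨i', b⟩ | ⟨i', c, d⟩)
  · fin_cases j <;> cases b <;> simp [sBf]
  · simp [sBf]
  · by_cases h : i' = i <;> cases c <;> simp [sBf, h]

def sA {m : ℕ} : Option (Fin m) → Equiv.Perm (TV m)
  | none => 1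
  | some i => (sAf_invol i).toPerm

def sB {m : ℕ} : Option (Fin m) → Equiv.Perm (TV m)
  | none => 1
  | some i => (sBf_invol i).toPerm

theorem uu_sA {m : ℕ} (z : Option (Fin m) → Bool) (s : Option (Fin m)) :
    uu z ∘ sA s = uu (z ∘ Equiv.swap none s) := by
  cases s with
  | none => funext v; simp [sA, Equiv.swap_self]
  | some i =>
    funext v
    change uu z (sAf i v) = _
    rcases v with (⟨j, b⟩ | ⟨i', b⟩ | ⟨i', c, d⟩)
    · fin_cases j <;> cases b <;> simp [sAf, uu, tokU]
    · by_cases h : i' = i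
      · subst h; cases b <;> simp [sAf, uu, tokU]
      · have : Equiv.swap none (some i) (some i') = some i' :=
          Equiv.swap_apply_of_ne_of_ne (by simp) (by simpa using h)
        simp [sAf, uu, h, this]
    · simp [sAf, uu]

theorem uu_sB {m : ℕ} (z : Option (Fin m) → Bool) (s : Option (Fin m)) (hz : z none = false) :
    uu z ∘ sB s = uu z := by
  cases s with
  | none => funext v; simp [sB]
  | some i =>
    funext v
    change uu z (sBf i v) = _
    rcases v with (⟨j, b⟩ | ⟨i', b⟩ | ⟨i', c, d⟩)
    · fin_cases j <;> cases b <;> simp [sBf, uu, tokU, hz]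
    · simp [sBf, uu]
    · by_cases h : i' = i <;> cases c <;> simp [sBf, uu, tokU, hz, h]

theorem MM_sA {m : ℕ} (y : Option (Fin m) → Bool) (s : Option (Fin m)) (hy : y none = false) :
    (sA s)⁻¹ * MM y * sA s = MM y := by
  cases s with
  | none => simp [sA]
  | some i =>
    rw [mul_assoc, inv_mul_eq_iff_eq_mul]
    ext1 v
    change MMf y (sAf i v) = sAf i (MMf y v)
    rcases v with (⟨j, b⟩ | ⟨i', b⟩ | ⟨i', c, d⟩)
    · fin_cases j <;> cases b <;> simp [sAf, MMf, tokM, hy]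
    · by_cases h : i' = i <;> cases b <;> simp [sAf, MMf, tokM, hy, h]
    · simp [sAf, MMf]

theorem MM_sB {m : ℕ} (y : Option (Fin m) → Bool) (s : Option (Fin m)) :
    (sB s)⁻¹ * MM y * sB s = MM (y ∘ Equiv.swap none s) := by
  cases s with
  | none => simp [sB, Equiv.swap_self]
  | some i =>
    rw [mul_assoc, inv_mul_eq_iff_eq_mul]
    ext1 v
    change MMf y (sBf i v) = sBf i (MMf _ v)
    rcases v with (⟨j, b⟩ | ⟨i', b⟩ | ⟨i', c, d⟩)
    · cases hy : y (some i) <;> fin_cases j <;> cases b <;> simp [sBf, MMf, tokM, hy]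
    · simp [sBf, MMf]
    · by_cases h : i' = i
      · subst h
        cases hy : y none <;> cases c <;> cases d <;> simp [sBf, MMf, tokM, hy]
      · have : Equiv.swap none (some i) (some i') = some i' :=
          Equiv.swap_apply_of_ne_of_ne (by simp) (by simpa using h)
        simp [sBf, MMf, h, this]

def rot {m : ℕ} (j : Fin 5) : Equiv.Perm (TV m) :=
  Equiv.sumCongr (Equiv.prodCongr (Equiv.addRight j) (Equiv.refl _)) (Equiv.refl _)

theorem tokU_true : ∀ (j : Fin 5) p, tokU true (p.1 + j, p.2) = tokU true p := by decide
theorem tokM_true : ∀ (j : Fin 5) p, tokM true (p.1 + j, p.2) =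
  ((tokM true p).1 + j, (tokM true p).2) := by decide

theorem uu_rot {m : ℕ} (z : Option (Fin m) → Bool) (j : Fin 5) (hz : z none = true) :
    uu z ∘ rot j = uu z := by
  funext v
  rcases v with (p | q | q)
  · simpa [rot, uu, hz, Prod.map] using tokU_true j p
  · simp [rot, uu]
  · simp [rot, uu]

theorem MM_rot {m : ℕ} (y : Option (Fin m) → Bool) (j : Fin 5) (hy : y none = true) :
    (rot j)⁻¹ * MM y * rot j = MM y := by
  rw [mul_assoc, inv_mul_eq_iff_eq_mul]
  ext1 v
  rcases v with (p | ⟨i', b⟩ | ⟨i', c, d⟩)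
  · simpa [rot, MMf, hy, Prod.map] using tokM_true j p
  · simp [rot, MMf]
  · simp [rot, MMf]

/-- doubled number of crossing edges -/
def DD {V : Type*} [Fintype V] (u : V → Bool) (M : Equiv.Perm V) : ℕ :=
  (Finset.univ.filter (fun v => u v ≠ u (M v))).card

theorem DD_conj {V : Type*} [Fintype V] (u : V → Bool) (M τ : Equiv.Perm V) :
    DD (u ∘ τ) (τ⁻¹ * M * τ) = DD u M := by
  unfold DD
  apply Finset.card_equiv τ
  intro v
  simp

theorem DD_template {m : ℕ} (z y : Option (Fin m) → Bool) (j l : Fin 5) :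
    DD (uu z ∘ rot j) ((rot l)⁻¹ * MM y * rot l) =
      (Finset.univ.filter (fun p : Fin 5 × Bool => tokU (z none) (p.1 + j, p.2) ≠
        tokU (z none) ((tokM (y none) (p.1 + l, p.2)).1 - l + j,
          (tokM (y none) (p.1 + l, p.2)).2))).card := by
  unfold DD
  symm
  apply Finset.card_bij (fun p _ => (Sum.inl p : TV m))
  · intro p hp
    simpa [rot, uu, MMf, Equiv.Perm.inv_def, sub_eq_add_neg, Prod.map] using hp
  · intro p _ q _ h
    exact Sum.inl_injective h
  · rintro (p | ⟨i', b⟩ | ⟨i', c, d⟩) h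
    · refine ⟨p, ?_, rfl⟩
      simpa [rot, uu, MMf, Equiv.Perm.inv_def, sub_eq_add_neg, Prod.map] using h
    · simp [rot, uu, MMf, Equiv.Perm.inv_def] at h
    · simp [rot, uu, MMf, Equiv.Perm.inv_def] at h

theorem rot_zero {m : ℕ} : (rot 0 : Equiv.Perm (TV m)) = 1 := by
  ext1 v
  rcases v with (p | q | q) <;> simp [rot]

theorem DD_base {m : ℕ} (z y : Option (Fin m) → Bool) :
    DD (uu z) (MM y) = if z none = true ∧ y none = true then 10 else 6 := by
  have := DD_template z y 0 0
  rw [rot_zero] at this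
  simp only [inv_one, one_mul, mul_one, Equiv.Perm.coe_one, Function.comp_id] at this
  rw [this]
  cases z none <;> cases y none <;> decide

theorem DD_shift {m : ℕ} (z y : Option (Fin m) → Bool) (j : Fin 5) (hz : z none = false)
    (hy : y none = false) :
    DD (uu z ∘ rot j) ((rot (j + 2))⁻¹ * MM y * rot (j + 2)) = 2 := by
  rw [DD_template, hz, hy]
  revert j
  decide


section core
variable {m : ℕ}

noncomputable def aa (f : (TV m → Bool) → ℝ) (c : Bool) (τ : Equiv.Perm (TV m)) : ℝ :=
  ∑ z : Option (Fin m) → Bool, if z none = c then f (uu z ∘ τ) else 0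

noncomputable def bb (g : Equiv.Perm (TV m) → ℝ) (c : Bool) (τ : Equiv.Perm (TV m)) : ℝ :=
  ∑ y : Option (Fin m) → Bool, if y none = c then g (τ⁻¹ * MM y * τ) else 0

theorem swap_reindex (s : Option (Fin m)) (G : (Option (Fin m) → Bool) → ℝ) (c : Bool) :
    (∑ z : Option (Fin m) → Bool, if z none = c then G (z ∘ Equiv.swap none s) else 0)
      = ∑ z : Option (Fin m) → Bool, if z s = c then G z else 0 := by
  have hinv : Function.Involutive
      (fun z : Option (Fin m) → Bool => z ∘ Equiv.swap none s) := by
    intro z; funext i; simp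
  apply Fintype.sum_equiv hinv.toPerm
  intro z
  simp

theorem aa_sA (f : (TV m → Bool) → ℝ) (c : Bool) (s) (τ : Equiv.Perm (TV m)) :
    aa f c (sA s * τ) = ∑ z : Option (Fin m) → Bool, if z s = c then f (uu z ∘ τ) else 0 := by
  rw [← swap_reindex s (fun z => f (uu z ∘ τ)) c]
  unfold aa
  apply Finset.sum_congr rfl
  intro z _
  rw [← uu_sA]
  rfl

theorem bb_sB (g : Equiv.Perm (TV m) → ℝ) (c : Bool) (s) (τ : Equiv.Perm (TV m)) :
    bb g c (sB s * τ) =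
      ∑ y : Option (Fin m) → Bool, if y s = c then g (τ⁻¹ * MM y * τ) else 0 := by
  rw [← swap_reindex s (fun y => g (τ⁻¹ * MM y * τ)) c]
  unfold bb
  apply Finset.sum_congr rfl
  intro y _
  rw [← MM_sB]
  simp only [mul_inv_rev, mul_assoc]

theorem aa_sB (f : (TV m → Bool) → ℝ) (s) (τ : Equiv.Perm (TV m)) :
    aa f false (sB s * τ) = aa f false τ := by
  unfold aa
  apply Finset.sum_congr rfl
  intro z _
  split_ifs with h
  · conv_rhs => rw [← uu_sB z s h]
    rfl
  · rfl

theorem bb_sA (g : Equiv.Perm (TV m) → ℝ) (s) (τ : Equiv.Perm (TV m)) :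
    bb g false (sA s * τ) = bb g false τ := by
  unfold bb
  apply Finset.sum_congr rfl
  intro z _
  split_ifs with h
  · conv_rhs => rw [← MM_sA z s h]
    simp only [mul_inv_rev, mul_assoc]
  · rfl

theorem aa_rot (f : (TV m → Bool) → ℝ) (j) (τ : Equiv.Perm (TV m)) :
    aa f true (rot j * τ) = aa f true τ := by
  unfold aa
  apply Finset.sum_congr rfl
  intro z _
  split_ifs with h
  · conv_rhs => rw [← uu_rot z j h]
    rfl
  · rfl

theorem bb_rot (g : Equiv.Perm (TV m) → ℝ) (j) (τ : Equiv.Perm (TV m)) :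
    bb g true (rot j * τ) = bb g true τ := by
  unfold bb
  apply Finset.sum_congr rfl
  intro z _
  split_ifs with h
  · conv_rhs => rw [← MM_rot z j h]
    simp only [mul_inv_rev, mul_assoc]
  · rfl

theorem aa_nonneg {f : (TV m → Bool) → ℝ} (hf : ∀ u, 0 ≤ f u) (c τ) : 0 ≤ aa f c τ :=
  Finset.sum_nonneg (fun z _ => by split_ifs <;> simp [hf])

theorem bb_nonneg {g : Equiv.Perm (TV m) → ℝ} (hg : ∀ u, 0 ≤ g u) (c τ) : 0 ≤ bb g c τ :=
  Finset.sum_nonneg (fun z _ => by split_ifs <;> simp [hg])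

theorem ite_sum_le (G : (Option (Fin m) → Bool) → ℝ) (h1 : ∀ z, G z ≤ 1) (c : Bool) :
    (∑ z : Option (Fin m) → Bool, if z none = c then G z else 0) ≤ 2 ^ (m + 1) := by
  calc _ ≤ ∑ z : Option (Fin m) → Bool, (1:ℝ) := by
        apply Finset.sum_le_sum; intro z _; split_ifs <;> simp [h1]
    _ = _ := by simp [Finset.card_univ]

theorem sum_split (G : (Option (Fin m) → Bool) → ℝ) :
    ∑ z, G z = (∑ z : Option (Fin m) → Bool, if z none = false then G z else 0) +
      ∑ z : Option (Fin m) → Bool, if z none = true then G z else 0 := by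
  rw [← Finset.sum_add_distrib]
  apply Finset.sum_congr rfl
  intro z _
  cases z none <;> simp

theorem sum_shift {G : Type*} [Fintype G] [Group G] (σ : G) (F : G → ℝ) :
    ∑ τ, F (σ * τ) = ∑ τ, F τ := Fintype.sum_equiv (Equiv.mulLeft σ) _ _ (fun _ => rfl)

theorem sum_avg {G ι : Type*} [Fintype G] [Group G] [Fintype ι] (σ : ι → G) (F : G → ℝ) :
    Fintype.card ι * ∑ τ, F τ = ∑ τ, ∑ s, F (σ s * τ) := by
  rw [Finset.sum_comm]
  simp_rw [sum_shift]
  simp [Finset.card_univ]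

theorem bad_bound {G : Type*} [Fintype G] [Group G] (σ : Option (Fin m) → G)
    (p q r : G → ℝ) (F : G → (Option (Fin m) → Bool) → ℝ)
    (hF0 : ∀ τ z, 0 ≤ F τ z) (hF1 : ∀ τ z, F τ z ≤ 1)
    (hp : ∀ s τ, p (σ s * τ) = ∑ z, if z s = false then F τ z else 0)
    (hq : ∀ s τ, q (σ s * τ) = ∑ z, if z s = true then F τ z else 0)
    (hp1 : ∀ τ, p τ = ∑ z, if z none = false then F τ z else 0)
    (hq1 : ∀ τ, q τ = ∑ z, if z none = true then F τ z else 0)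
    (hr : ∀ s τ, r (σ s * τ) = r τ) (hr0 : ∀ τ, 0 ≤ r τ) (hr1 : ∀ τ, r τ ≤ 2 ^ (m+1)) :
    ∑ τ, r τ * (if 1.05 * q τ < p τ then p τ else 0) ≤
      0.005 * ∑ τ, (r τ * p τ + r τ * q τ) +
        Fintype.card G * 4 ^ (m+1) * Real.exp (-0.000001 * (m+1)) := by
  have hcard : (0:ℝ) < Fintype.card (Option (Fin m)) := by
    exact_mod_cast Fintype.card_pos
  have hN : (Fintype.card (Option (Fin m)) : ℝ) = m + 1 := by simp
  have hN' : Fintype.card (Option (Fin m)) = m + 1 := by simp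
  have key := sum_avg σ (fun τ => r τ * (if 1.05 * q τ < p τ then p τ else 0))
  have h2 : ∀ τ, ∑ s, r (σ s * τ) * (if 1.05 * q (σ s * τ) < p (σ s * τ) then p (σ s * τ) else 0)
      ≤ Fintype.card (Option (Fin m)) * (0.005 * (r τ * p τ + r τ * q τ) +
        4 ^ (m+1) * Real.exp (-0.000001 * (m+1))) := by
    intro τ
    have hl := level_one (F τ) (hF0 τ) (hF1 τ) (fun s => p (σ s * τ)) (fun s => q (σ s * τ))
      (fun s => hp s τ) (fun s => hq s τ)
    rw [sum_split, ← hp1, ← hq1] at hl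
    simp_rw [hr, ← Finset.mul_sum]
    have e := Real.exp_pos (-0.000001 * ((m:ℝ)+1))
    calc _ ≤ r τ * _ := mul_le_mul_of_nonneg_left hl (hr0 τ)
      _ = Fintype.card (Option (Fin m)) * (0.005 * (r τ * p τ + r τ * q τ) +
            r τ * 2 ^ (m+1) * Real.exp (-0.000001 * (m+1))) := by
          rw [hN', hN'.symm, hN, hN']; ring
      _ ≤ Fintype.card (Option (Fin m)) * (0.005 * (r τ * p τ + r τ * q τ) +
            2 ^ (m+1) * 2 ^ (m+1) * Real.exp (-0.000001 * (m+1))) := by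
          gcongr; exact hr1 τ
      _ = _ := by
          rw [← mul_pow]; norm_num
  have h3 := Finset.sum_le_sum (fun τ (_ : τ ∈ Finset.univ) => h2 τ)
  rw [← key, ← Finset.mul_sum] at h3
  have h4 := le_of_mul_le_mul_left h3 hcard
  refine h4.trans (le_of_eq ?_)
  rw [Finset.sum_add_distrib, ← Finset.mul_sum]
  simp [Finset.card_univ, mul_assoc]

theorem five_free : ∀ P : Finset (Fin 5), (∀ j, j ∈ P → j + 2 ∈ P → False) → P.card ≤ 2 := by
  decide

theorem core_bound (f : (TV m → Bool) → ℝ) (g : Equiv.Perm (TV m) → ℝ)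
    (hf0 : ∀ u, 0 ≤ f u) (hf1 : ∀ u, f u ≤ 1) (hg0 : ∀ M, 0 ≤ g M) (hg1 : ∀ M, g M ≤ 1)
    (hfree : ∀ u M, DD u M = 2 → f u * g M = 0) :
    ∑ τ, (0.99 * (aa f false τ * bb g false τ) - 0.441 * (aa f true τ * bb g true τ)
      - 0.005 * (aa f true τ * bb g false τ) - 0.005 * (aa f false τ * bb g true τ)) ≤
      2 * (Fintype.card (Equiv.Perm (TV m)) * 4 ^ (m+1) * Real.exp (-0.000001 * (m+1))) := by
  have hA := bad_bound sA (aa f false) (aa f true) (bb g false) (fun τ z => f (uu z ∘ τ))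
    (fun _ _ => hf0 _) (fun _ _ => hf1 _) (fun s τ => aa_sA f _ s τ) (fun s τ => aa_sA f _ s τ)
    (fun _ => rfl) (fun _ => rfl) (fun s τ => bb_sA g s τ) (fun τ => bb_nonneg hg0 _ τ)
    (fun τ => ite_sum_le _ (fun _ => hg1 _) _)
  have hB := bad_bound sB (bb g false) (bb g true) (aa f false) (fun τ y => g (τ⁻¹ * MM y * τ))
    (fun _ _ => hg0 _) (fun _ _ => hg1 _) (fun s τ => bb_sB g _ s τ) (fun s τ => bb_sB g _ s τ)
    (fun _ => rfl) (fun _ => rfl) (fun s τ => aa_sB f s τ) (fun τ => aa_nonneg hf0 _ τ)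
    (fun τ => ite_sum_le _ (fun _ => hf1 _) _)
  -- the good part
  let G : Equiv.Perm (TV m) → ℝ := fun τ =>
    if aa f false τ ≤ 1.05 * aa f true τ ∧ bb g false τ ≤ 1.05 * bb g true τ then
      aa f false τ * bb g false τ else 0
  have hG : ∑ τ, G τ ≤ 0.441 * ∑ τ, aa f true τ * bb g true τ := by
    have key := sum_avg (rot (m := m)) G
    have h2 : ∀ τ, ∑ j, G (rot j * τ) ≤ 2.205 * (aa f true τ * bb g true τ) := by
      intro τ
      have hnn : 0 ≤ aa f true τ * bb g true τ :=
        mul_nonneg (aa_nonneg hf0 _ _) (bb_nonneg hg0 _ _)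
      let P : Finset (Fin 5) := Finset.univ.filter
        (fun j => aa f false (rot j * τ) ≠ 0 ∧ bb g false (rot j * τ) ≠ 0)
      have hP : P.card ≤ 2 := by
        apply five_free
        intro j hj hj2
        simp only [P, Finset.mem_filter, Finset.mem_univ, true_and] at hj hj2
        obtain ⟨z, _, hz⟩ := Finset.exists_ne_zero_of_sum_ne_zero hj.1
        obtain ⟨y, _, hy⟩ := Finset.exists_ne_zero_of_sum_ne_zero hj2.2
        simp only [ne_eq, ite_eq_right_iff, Classical.not_imp] at hz hy
        have h1 := DD_shift z y j hz.1 hy.1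
        rw [← DD_conj _ _ τ] at h1
        have h3 := hfree _ _ h1
        rcases mul_eq_zero.mp h3 with h | h
        · exact hz.2 h
        · apply hy.2
          rw [← h]
          simp only [mul_inv_rev, mul_assoc]
      have h4 : ∀ j, G (rot j * τ) ≤
          if j ∈ P then 1.1025 * (aa f true τ * bb g true τ) else 0 := by
        intro j
        simp only [G]
        split_ifs with h5 h6 h6
        · rw [aa_rot, bb_rot] at h5
          calc _ ≤ (1.05 * aa f true τ) * (1.05 * bb g true τ) :=
                mul_le_mul h5.1 h5.2 (bb_nonneg hg0 _ _)
                  (mul_nonneg (by norm_num) (aa_nonneg hf0 _ _))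
            _ = _ := by ring
        · simp only [P, Finset.mem_filter, Finset.mem_univ, true_and, not_and_or, not_not] at h6
          rcases h6 with h | h <;> simp [h]
        · exact mul_nonneg (by norm_num) hnn
        · exact le_rfl
      calc _ ≤ ∑ j : Fin 5, if j ∈ P then 1.1025 * (aa f true τ * bb g true τ) else 0 :=
            Finset.sum_le_sum (fun j _ => h4 j)
        _ = P.card * (1.1025 * (aa f true τ * bb g true τ)) := by
            simp [Finset.sum_ite_mem]
        _ ≤ 2 * (1.1025 * (aa f true τ * bb g true τ)) := by
            gcongr; exact_mod_cast hP
        _ = _ := by ring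
    have h3 := Finset.sum_le_sum (fun τ (_ : τ ∈ Finset.univ) => h2 τ)
    rw [← key, ← Finset.mul_sum] at h3
    simp only [Fintype.card_fin] at h3
    push_cast at h3
    linarith
  have hsplit : ∑ τ, aa f false τ * bb g false τ ≤ ∑ τ, (G τ +
      bb g false τ * (if 1.05 * aa f true τ < aa f false τ then aa f false τ else 0) +
      aa f false τ * (if 1.05 * bb g true τ < bb g false τ then bb g false τ else 0)) := by
    apply Finset.sum_le_sum
    intro τ _
    have hnn : 0 ≤ aa f false τ * bb g false τ :=
      mul_nonneg (aa_nonneg hf0 _ _) (bb_nonneg hg0 _ _)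
    simp only [G]
    split_ifs with h1 h2 h3 h3 h2 h3 h3 <;> try linarith
    exact absurd ⟨not_lt.mp h2, not_lt.mp h3⟩ h1
  simp only [Finset.sum_add_distrib, Finset.sum_sub_distrib, ← Finset.mul_sum] at hsplit hA hB ⊢
  have c1 : ∑ τ, bb g false τ * aa f false τ = ∑ τ, aa f false τ * bb g false τ :=
    Finset.sum_congr rfl (fun _ _ => mul_comm _ _)
  have c2 : ∑ τ, bb g false τ * aa f true τ = ∑ τ, aa f true τ * bb g false τ :=
    Finset.sum_congr rfl (fun _ _ => mul_comm _ _)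
  rw [c1, c2] at hA
  linarith

end core


section rank
variable {m : ℕ}

def OddU {V : Type*} [Fintype V] (u : V → Bool) : Prop := Odd (∑ v, if u v = true then 1 else 0)

def FPF {V : Type*} (M : Equiv.Perm V) : Prop := ∀ v, M (M v) = v ∧ M v ≠ v

theorem OddU_uu (z : Option (Fin m) → Bool) (τ : Equiv.Perm (TV m)) : OddU (uu z ∘ τ) := by
  unfold OddU
  have h : (∑ v, if (uu z ∘ τ) v = true then 1 else 0) = ∑ v, if uu z v = true then 1 else 0 :=
    Equiv.sum_comp τ (fun v => if uu z v = true then 1 else 0)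
  rw [h, Fintype.sum_sum_type, Fintype.sum_sum_type]
  have h1 : Odd (∑ p : Fin 5 × Bool, if uu z (Sum.inl p) = true then 1 else 0) := by
    have h0 : ∀ c, Odd (∑ p : Fin 5 × Bool, if tokU c p = true then 1 else 0) := by decide
    exact h0 (z none)
  have h2 : Even (∑ p : Fin m × Bool, if uu z (Sum.inr (Sum.inl p)) = true then 1 else 0) := by
    rw [Fintype.sum_prod_type]
    apply Finset.even_sum
    intro i _
    simp only [uu, Fintype.sum_bool]
    exact ⟨_, rfl⟩
  have h3 : (∑ p : Fin m × (Bool × Bool), if uu z (Sum.inr (Sum.inr p)) = true then 1 else 0)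
      = 0 := by
    simp [uu]
  rw [h3, add_zero]
  exact h1.add_even h2

theorem FPF_MM (y : Option (Fin m) → Bool) (τ : Equiv.Perm (TV m)) :
    FPF (τ⁻¹ * MM y * τ) := by
  intro v
  constructor
  · have h : (τ⁻¹ * MM y * τ) ((τ⁻¹ * MM y * τ) v) = τ⁻¹ (MM y (MM y (τ v))) := by
      simp [Equiv.Perm.mul_apply]
    rw [h, MM_apply, MM_apply, MMf_invol y]
    simp
  · simp only [Equiv.Perm.mul_apply, MM_apply]
    intro h
    rw [Equiv.Perm.inv_eq_iff_eq] at h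
    exact MMf_ne y _ h

noncomputable def WW (c d : Bool) : ℝ :=
  if c then (if d then -0.441 else -0.005) else (if d then -0.005 else 0.99)

theorem phi_eq (f : (TV m → Bool) → ℝ) (g : Equiv.Perm (TV m) → ℝ) (τ : Equiv.Perm (TV m)) :
    (0.99 * (aa f false τ * bb g false τ) - 0.441 * (aa f true τ * bb g true τ)
      - 0.005 * (aa f true τ * bb g false τ) - 0.005 * (aa f false τ * bb g true τ))
    = ∑ z : Option (Fin m) → Bool, ∑ y : Option (Fin m) → Bool,
        WW (z none) (y none) * (f (uu z ∘ τ) * g (τ⁻¹ * MM y * τ)) := by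
  unfold aa bb
  simp only [Finset.sum_mul_sum]
  simp only [Finset.mul_sum, ← Finset.sum_sub_distrib]
  apply Finset.sum_congr rfl; intro z _
  apply Finset.sum_congr rfl; intro y _
  cases z none <;> cases y none <;> simp [WW]

theorem sum_none (h : Bool → ℝ) :
    ∑ z : Option (Fin m) → Bool, h (z none) = 2 ^ m * (h false + h true) := by
  rw [Fintype.sum_equiv (Equiv.piOptionEquivProd (α := Fin m) (β := fun _ => Bool))
    (fun z => h (z none)) (fun p => h p.1) (fun z => rfl), Fintype.sum_prod_type]
  simp [Finset.card_univ]
  ring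

theorem DD_le (u : TV m → Bool) (M) : DD u M ≤ 6 * m + 10 := by
  unfold DD
  refine (Finset.card_le_univ _).trans (le_of_eq ?_)
  simp [Fintype.card_sum, Fintype.card_prod]; ring

theorem term_bound (f : (TV m → Bool) → ℝ) (g : Equiv.Perm (TV m) → ℝ)
    (hf0 : ∀ u, 0 ≤ f u) (hg0 : ∀ M, 0 ≤ g M) (B : ℝ) (hB : ∀ u M, f u * g M ≤ B)
    (hfree : ∀ u M, DD u M = 2 → f u * g M = 0) :
    ∑ τ : Equiv.Perm (TV m), ∑ z : Option (Fin m) → Bool, ∑ y : Option (Fin m) → Bool,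
        WW (z none) (y none) * (f (uu z ∘ τ) * g (τ⁻¹ * MM y * τ)) ≤
      B * (2 * (Fintype.card (Equiv.Perm (TV m)) * 4 ^ (m+1) * Real.exp (-0.000001 * (m+1)))) := by
  obtain ⟨u0, hu0⟩ := Finite.exists_max f
  obtain ⟨M0, hM0⟩ := Finite.exists_max g
  have hR : 0 ≤ 2 * ((Fintype.card (Equiv.Perm (TV m)) : ℝ) * 4 ^ (m+1) *
      Real.exp (-0.000001 * (m+1))) := by positivity
  have hBn : 0 ≤ B := (mul_nonneg (hf0 u0) (hg0 M0)).trans (hB u0 M0)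
  rcases (hf0 u0).eq_or_lt with h0 | hF
  · have : ∀ u, f u = 0 := fun u => le_antisymm (h0 ▸ hu0 u) (hf0 u)
    simp only [this, zero_mul, mul_zero, Finset.sum_const_zero]
    exact mul_nonneg hBn hR
  rcases (hg0 M0).eq_or_lt with h0 | hG
  · have : ∀ M, g M = 0 := fun M => le_antisymm (h0 ▸ hM0 M) (hg0 M)
    simp only [this, mul_zero, Finset.sum_const_zero]
    exact mul_nonneg hBn hR
  have key := core_bound (fun u => f u / f u0) (fun M => g M / g M0)
    (fun u => div_nonneg (hf0 u) hF.le) (fun u => (div_le_one hF).2 (hu0 u))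
    (fun u => div_nonneg (hg0 u) hG.le) (fun u => (div_le_one hG).2 (hM0 u))
    (fun u M h => by rw [div_mul_div_comm, hfree u M h, zero_div])
  simp only [phi_eq] at key
  have e : ∑ τ : Equiv.Perm (TV m), ∑ z : Option (Fin m) → Bool, ∑ y : Option (Fin m) → Bool,
        WW (z none) (y none) * (f (uu z ∘ τ) * g (τ⁻¹ * MM y * τ)) =
      (f u0 * g M0) * ∑ τ : Equiv.Perm (TV m), ∑ z : Option (Fin m) → Bool, ∑ y : Option (Fin m) → Bool,
        WW (z none) (y none) * (f (uu z ∘ τ) / f u0 * (g (τ⁻¹ * MM y * τ) / g M0)) := by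
    simp only [Finset.mul_sum]
    apply Finset.sum_congr rfl; intro τ _
    apply Finset.sum_congr rfl; intro z _
    apply Finset.sum_congr rfl; intro y _
    field_simp
  rw [e]
  calc _ ≤ (f u0 * g M0) * _ := mul_le_mul_of_nonneg_left key (mul_nonneg hF.le hG.le)
    _ ≤ _ := mul_le_mul_of_nonneg_right (hB u0 M0) hR

theorem rank_bound {ι : Type*} [Fintype ι] (F : ι → (TV m → Bool) → ℝ)
    (G : ι → Equiv.Perm (TV m) → ℝ)
    (hF : ∀ i u, OddU u → 0 ≤ F i u) (hG : ∀ i M, FPF M → 0 ≤ G i M)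
    (hS : ∀ u M, OddU u → FPF M → ∑ i, F i u * G i M = (DD u M : ℝ) / 2 - 1) :
    (0.196 : ℝ) ≤ Fintype.card ι * (6 * m + 10) * 8 * Real.exp (-0.000001 * (m+1)) := by
  classical
  let f : ι → (TV m → Bool) → ℝ := fun i u => if OddU u then F i u else 0
  let g : ι → Equiv.Perm (TV m) → ℝ := fun i M => if FPF M then G i M else 0
  have hf0 : ∀ i u, 0 ≤ f i u := by
    intro i u; simp only [f]; split_ifs with h
    · exact hF i u h
    · exact le_rfl
  have hg0 : ∀ i u, 0 ≤ g i u := by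
    intro i u; simp only [g]; split_ifs with h
    · exact hG i u h
    · exact le_rfl
  have hle : ∀ i u M, OddU u → FPF M → f i u * g i M ≤ (DD u M : ℝ) / 2 - 1 := by
    intro i u M hu hM
    rw [← hS u M hu hM]
    have := Finset.single_le_sum (f := fun i => f i u * g i M) (s := Finset.univ)
      (fun i _ => mul_nonneg (hf0 i u) (hg0 i M)) (Finset.mem_univ i)
    simpa [f, g, hu, hM] using this
  have hz : ∀ i u M, ¬ (OddU u ∧ FPF M) → f i u * g i M = 0 := by
    intro i u M h
    simp only [f, g]
    rcases not_and_or.mp h with h | h <;> simp [h]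
  have hb : ∀ i, _ := fun i => term_bound (f i) (g i) (hf0 i) (hg0 i) (6 * m + 10)
    (fun u M => by
      by_cases h : OddU u ∧ FPF M
      · refine (hle i u M h.1 h.2).trans ?_
        have : (DD u M : ℝ) ≤ 6 * m + 10 := by exact_mod_cast DD_le u M
        have : (0:ℝ) ≤ DD u M := by positivity
        linarith
      · rw [hz i u M h]; positivity)
    (fun u M hD => by
      by_cases h : OddU u ∧ FPF M
      · refine le_antisymm ((hle i u M h.1 h.2).trans ?_) (mul_nonneg (hf0 _ _) (hg0 _ _))
        rw [hD]; norm_num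
      · exact hz i u M h)
  have hsum := Finset.sum_le_sum (fun i (_ : i ∈ Finset.univ) => hb i)
  rw [Finset.sum_comm] at hsum
  have e : ∀ τ : Equiv.Perm (TV m), ∑ i, ∑ z : Option (Fin m) → Bool,
      ∑ y : Option (Fin m) → Bool,
        WW (z none) (y none) * (f i (uu z ∘ τ) * g i (τ⁻¹ * MM y * τ)) = 4 ^ m * 0.196 := by
    intro τ
    rw [Finset.sum_comm]
    have : ∀ z : Option (Fin m) → Bool, ∑ i, ∑ y : Option (Fin m) → Bool,
        WW (z none) (y none) * (f i (uu z ∘ τ) * g i (τ⁻¹ * MM y * τ)) =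
        ∑ y : Option (Fin m) → Bool, WW (z none) (y none) *
          (if z none = true ∧ y none = true then 4 else 2) := by
      intro z
      rw [Finset.sum_comm]
      apply Finset.sum_congr rfl; intro y _
      rw [← Finset.mul_sum]
      congr 1
      have h1 := hS _ _ (OddU_uu z τ) (FPF_MM y τ)
      rw [DD_conj, DD_base] at h1
      simp only [f, g, OddU_uu, FPF_MM, if_true, h1]
      split_ifs <;> norm_num
    simp only [this]
    have h2 : ∀ c, ∑ y : Option (Fin m) → Bool, WW c (y none) *
          (if c = true ∧ y none = true then 4 else 2) = _ := fun c =>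
      sum_none (fun d => WW c d * (if c = true ∧ d = true then 4 else 2))
    rw [Finset.sum_congr rfl (fun z _ => h2 (z none)), sum_none (fun c => (2:ℝ)^m * (WW c false * (if c = true ∧ false = true then 4 else 2) +
      WW c true * (if c = true ∧ true = true then 4 else 2)))]
    have : (4:ℝ) ^ m = 2 ^ m * 2 ^ m := by rw [← mul_pow]; norm_num
    rw [this]
    simp [WW]
    ring
  simp only [e, Finset.sum_const, Finset.card_univ, nsmul_eq_mul] at hsum
  have hP : (0:ℝ) < Fintype.card (Equiv.Perm (TV m)) * 4 ^ m := by
    have : 0 < Fintype.card (Equiv.Perm (TV m)) := Fintype.card_pos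
    positivity
  refine le_of_mul_le_mul_left (a := (Fintype.card (Equiv.Perm (TV m)) : ℝ) * 4 ^ m) ?_ hP
  rw [pow_succ] at hsum
  linarith

end rank


section tour

/-- the sum of a weight over the consecutive pairs of `a :: l` -/
noncomputable def ps {α : Type*} (w : α → α → ℝ) : α → List α → ℝ
  | _, [] => 0
  | a, b :: t => w a b + ps w b t

theorem ps_add {α : Type*} (w w' : α → α → ℝ) (a : α) (l : List α) :
    ps (fun p q => w p q + w' p q) a l = ps w a l + ps w' a l := by
  induction l generalizing a with
  | nil => simp [ps]
  | cons b t ih => simp only [ps, ih]; ring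

theorem ps_sum {α ι : Type*} (s : Finset ι) (w : ι → α → α → ℝ) (a : α) (l : List α) :
    ps (fun p q => ∑ i ∈ s, w i p q) a l = ∑ i ∈ s, ps (w i) a l := by
  induction l generalizing a with
  | nil => simp [ps]
  | cons b t ih => simp only [ps, ih, Finset.sum_add_distrib]

theorem ps_map {α β : Type*} (e : α → β) (w : β → β → ℝ) (a : α) (l : List α) :
    ps w (e a) (l.map e) = ps (fun p q => w (e p) (e q)) a l := by
  induction l generalizing a with
  | nil => simp [ps]
  | cons b t ih => simp only [ps, List.map_cons, ih]

theorem exists_walk {n : ℕ} (a b : Fin n) (t : List (Fin n))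
    (h : List.IsChain (· ≠ ·) (a :: (t ++ [b]))) :
    ∃ p : (⊤ : SimpleGraph (Fin n)).Walk a b, p.support = a :: (t ++ [b]) ∧
      ∀ w : Sym2 (Fin n) → ℝ, (p.edges.map w).sum = ps (fun p q => w s(p, q)) a (t ++ [b]) := by
  induction t generalizing a with
  | nil =>
    simp at h
    exact ⟨Walk.cons (by simpa using h) Walk.nil, by simp, by simp [ps]⟩
  | cons c t ih =>
    rw [List.cons_append, List.isChain_cons_cons] at h
    obtain ⟨p, hp, hw⟩ := ih c h.2
    exact ⟨Walk.cons (by simpa using h.1) p, by simp [hp], by simp [ps, hw]⟩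

theorem exists_tour_fin {n : ℕ} (hn : 3 ≤ n) (a : Fin n) (t : List (Fin n))
    (hnd : (a :: t).Nodup) (hall : ∀ v, v ∈ a :: t) :
    ∃ x ∈ tspPolytope n, ∀ S : Finset (Fin n),
      cutSum S x = ps (fun p q => if (p ∈ S ↔ q ∈ S) then 0 else 1) a (t ++ [a]) := by
  have hlen : (a :: t).length = n := by
    have := List.toFinset_card_of_nodup hnd
    rw [← this]
    have : (a :: t).toFinset = Finset.univ := by
      ext v; simpa using hall v
    rw [this]; simp
  have hnd' : (t ++ [a]).Nodup := by
    rw [List.nodup_cons] at hnd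
    exact List.nodup_append_comm.mp (by simpa using hnd)
  have hchain : List.IsChain (· ≠ ·) (a :: (t ++ [a])) := by
    cases t with
    | nil => simp at hlen; omega
    | cons b t =>
      rw [List.cons_append, List.isChain_cons_cons]
      constructor
      · intro h; simp [h] at hnd
      · exact (List.Pairwise.isChain hnd')
  obtain ⟨p, hp, hw⟩ := exists_walk a a t hchain
  have hl : p.length = n := by
    have := p.length_support
    rw [hp] at this
    simp at this hlen
    omega
  have hcyc : p.IsCycle := by
    rw [Walk.isCycle_iff_isPath_tail_and_le_length]
    refine ⟨?_, by omega⟩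
    rw [Walk.isPath_def, Walk.support_tail_of_not_nil]
    · rw [hp]; exact hnd'
    · rw [Walk.not_nil_iff_lt_length]; omega
  refine ⟨fun e => if e.1 ∈ p.edges then (1 : ℝ) else 0, ?_, ?_⟩
  · apply subset_convexHull
    refine ⟨a, p, ?_, rfl⟩
    rw [Walk.isHamiltonianCycle_iff_isCycle_and_length_eq]
    exact ⟨hcyc, by simp [hl]⟩
  · intro S
    have hnde := hcyc.isTrail.edges_nodup
    have h1 := hw (fun e => if crossing S e then 1 else 0)
    have h2 : (fun p q => if crossing S s(p, q) then (1:ℝ) else 0)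
        = (fun p q => if (p ∈ S ↔ q ∈ S) then 0 else 1) := by
      funext p q
      by_cases hp : p ∈ S <;> by_cases hq : q ∈ S <;> simp [crossing, hp, hq]
    rw [h2] at h1
    rw [← h1, ← List.sum_toFinset _ hnde]
    unfold cutSum
    rw [Finset.sum_ite, Finset.sum_ite]
    simp only [Finset.sum_const_zero, add_zero, Finset.sum_const]
    congr 1
    apply Finset.card_bij (fun e _ => e.1)
    · intro e he
      simp at he ⊢
      exact ⟨he.2, he.1⟩
    · intro e _ e' _ h
      exact Subtype.ext h
    · intro e he
      simp at he
      have : ¬ e.IsDiag := SimpleGraph.not_isDiag_of_mem_edgeSet _ (p.edges_subset_edgeSet he.1)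
      exact ⟨⟨e, this⟩, by simp [he], rfl⟩

theorem exists_tour {X : Type*} {n : ℕ} (hn : 3 ≤ n) (e : X ≃ Fin n) (a : X) (t : List X)
    (hnd : (a :: t).Nodup) (hall : ∀ v, v ∈ a :: t) :
    ∃ x ∈ tspPolytope n, ∀ S : Finset X,
      cutSum (S.map e.toEmbedding) x =
        ps (fun p q => if (p ∈ S ↔ q ∈ S) then 0 else 1) a (t ++ [a]) := by
  obtain ⟨x, hx, h⟩ := exists_tour_fin hn (e a) (t.map e)
    (by rw [← List.map_cons]; exact hnd.map e.injective)
    (by intro v; rw [← List.map_cons, List.mem_map]; exact ⟨e.symm v, hall _, by simp⟩)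
  refine ⟨x, hx, fun S => ?_⟩
  rw [h]
  have : t.map e ++ [e a] = (t ++ [a]).map e := by simp
  rw [this, ps_map]
  congr 1
  funext p q
  simp

end tour


section comb
variable {V : Type*} [Fintype V] {r : ℕ}

abbrev XX (V : Type*) (r : ℕ) := ((V ⊕ Bool) × Fin 3) ⊕ Fin (r + 1)

def up (u : V → Bool) : V ⊕ Bool → Bool := Sum.elim u (fun _ => true)

noncomputable def ind (b : Bool) : ℝ := if b = true then 1 else 0

def inHand (u : V → Bool) : XX V r → Prop
  | Sum.inl (v, j) => up u v = true ∧ j = 0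
  | Sum.inr _ => True

noncomputable def hand (u : V → Bool) : Finset (XX V r) := Finset.univ.filter (inHand u)

noncomputable def tooth (v : V ⊕ Bool) : Finset (XX V r) :=
  Finset.univ.filter (fun x => ∃ j, x = Sum.inl (v, j))

theorem mem_hand_inl (u : V → Bool) (v j) :
    (Sum.inl (v, j) : XX V r) ∈ hand u ↔ (up u v = true ∧ j = 0) := by
  simp [hand, inHand]

theorem mem_hand_inr (u : V → Bool) (d) : (Sum.inr d : XX V r) ∈ hand u := by
  simp [hand, inHand]

theorem mem_tooth_inl (v v' : V ⊕ Bool) (j) :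
    (Sum.inl (v', j) : XX V r) ∈ tooth v ↔ v' = v := by
  simp [tooth]

theorem mem_tooth_inr (v : V ⊕ Bool) (d) : (Sum.inr d : XX V r) ∉ tooth v := by
  simp [tooth]

noncomputable def cr {X : Type*} (S : Finset X) (p q : X) : ℝ := if (p ∈ S ↔ q ∈ S) then 0 else 1

noncomputable def WT (u : V → Bool) (p q : XX V r) : ℝ :=
  cr (hand u) p q + ∑ v ∈ Finset.univ.filter (fun v => up u v = true), cr (tooth v) p q

theorem sum_ind (u : V → Bool) (a : V ⊕ Bool) :
    ∑ v ∈ Finset.univ.filter (fun v => up u v = true), (if a = v then (1:ℝ) else 0)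
      = ind (up u a) := by
  rw [Finset.sum_ite_eq]
  simp [ind]

theorem WT_same (u : V → Bool) (a : V ⊕ Bool) (j j' : Fin 3) :
    WT (r := r) u (Sum.inl (a, j)) (Sum.inl (a, j')) =
      if (j = 0 ↔ j' = 0) then 0 else ind (up u a) := by
  unfold WT cr
  simp only [mem_hand_inl, mem_tooth_inl]
  cases up u a <;> simp [ind]

theorem WT_diff (u : V → Bool) (a b : V ⊕ Bool) (hab : a ≠ b) (j j' : Fin 3) :
    WT (r := r) u (Sum.inl (a, j)) (Sum.inl (b, j')) =
      (if ((up u a = true ∧ j = 0) ↔ (up u b = true ∧ j' = 0)) then 0 else 1) +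
        (ind (up u a) + ind (up u b)) := by
  unfold WT cr
  simp only [mem_hand_inl, mem_tooth_inl]
  congr 1
  rw [← sum_ind u a, ← sum_ind u b, ← Finset.sum_add_distrib]
  apply Finset.sum_congr rfl
  intro v _
  by_cases h1 : a = v <;> by_cases h2 : b = v <;> simp [h1, h2]
  exact absurd (h1.trans h2.symm) hab

theorem WT_DD (u : V → Bool) (d d') : WT (r := r) u (Sum.inr d) (Sum.inr d') = 0 := by
  unfold WT cr
  simp [mem_hand_inr, mem_tooth_inr]

theorem WT_Dw (u : V → Bool) (d) (b : Bool) :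
    WT (r := r) u (Sum.inr d) (Sum.inl (Sum.inr b, 0)) = 1 := by
  unfold WT cr
  simp only [mem_hand_inr, mem_tooth_inr, mem_hand_inl, mem_tooth_inl]
  have := sum_ind u (Sum.inr b)
  simp [up, ind] at this ⊢
  exact this

theorem WT_wD (u : V → Bool) (d) (b : Bool) :
    WT (r := r) u (Sum.inl (Sum.inr b, 0)) (Sum.inr d) = 1 := by
  unfold WT cr
  simp only [mem_hand_inr, mem_tooth_inr, mem_hand_inl, mem_tooth_inl]
  have := sum_ind u (Sum.inr b)
  simp [up, ind] at this ⊢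
  exact this

def blk (M : Equiv.Perm V) (v : V) : List (XX V r) :=
  [Sum.inl (Sum.inl v, 2), Sum.inl (Sum.inl v, 1), Sum.inl (Sum.inl v, 0),
   Sum.inl (Sum.inl (M v), 0), Sum.inl (Sum.inl (M v), 1), Sum.inl (Sum.inl (M v), 2)]

def endl : List (XX V r) :=
  [Sum.inl (Sum.inr true, 2), Sum.inl (Sum.inr true, 1), Sum.inl (Sum.inr true, 0), Sum.inr 0]

noncomputable def gg (u : V → Bool) (M : Equiv.Perm V) (v : V) : ℝ :=
  3 * ind (u v) + 3 * ind (u (M v)) + (if u v = u (M v) then 0 else 1)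

theorem ps_blocks (u : V → Bool) (M : Equiv.Perm V) (hM : FPF M) (P : V → Prop)
    (hP : ∀ v, P v → ¬ P (M v)) (R : List V) (hR : ∀ v ∈ R, P v) (x : V ⊕ Bool)
    (hx : ∀ v, P v → x ≠ Sum.inl v) (hx' : x ≠ Sum.inr true) :
    ps (WT (r := r) u) (Sum.inl (x, 2)) (R.flatMap (blk M) ++ endl) =
      ind (up u x) + (R.map (gg u M)).sum + 3 := by
  induction R generalizing x with
  | nil =>
    simp only [List.flatMap_nil, List.nil_append, endl, ps]
    rw [WT_diff _ _ _ hx', WT_same, WT_same, WT_wD]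
    simp [up, ind]
    ring
  | cons v R ih =>
    have hv := hR v (by simp)
    have h2 := ih (fun w hw => hR w (by simp [hw])) (Sum.inl (M v))
      (fun w hw h => hP v hv (by rw [Sum.inl.inj h]; exact hw)) (by simp)
    simp only [List.flatMap_cons, blk, List.cons_append, List.nil_append, ps] at h2 ⊢
    rw [h2, WT_diff _ _ _ (hx v hv), WT_same, WT_same,
      WT_diff _ _ _ (fun h => (hM v).2 (Sum.inl.inj h).symm), WT_same, WT_same]
    simp only [List.map_cons, List.sum_cons, gg, up, Sum.elim_inl]
    rcases Bool.eq_false_or_eq_true (u v) with h3 | h3 <;>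
      rcases Bool.eq_false_or_eq_true (u (M v)) with h4 | h4 <;> simp [ind, h3, h4] <;> ring

theorem ps_D (u : V → Bool) (d : Fin (r+1)) (l : List (Fin (r+1))) (t : List (XX V r)) :
    ps (WT (r := r) u) (Sum.inr d) (l.map Sum.inr ++ (Sum.inl (Sum.inr false, 0) :: t)) =
      1 + ps (WT (r := r) u) (Sum.inl (Sum.inr false, 0)) t := by
  induction l generalizing d with
  | nil => simp [ps, WT_Dw]
  | cons b l ih => simp only [List.map_cons, List.cons_append, ps, ih, WT_DD, zero_add]

def rep (M : Equiv.Perm V) (v : V) : Prop :=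
  Fintype.equivFin V v < Fintype.equivFin V (M v)

theorem rep_iff (M : Equiv.Perm V) (hM : FPF M) (v : V) : rep M (M v) ↔ ¬ rep M v := by
  unfold rep
  rw [(hM v).1]
  have h : Fintype.equivFin V (M v) ≠ Fintype.equivFin V v :=
    fun h => (hM v).2 ((Fintype.equivFin V).injective h)
  constructor
  · intro h1; exact not_lt.mpr h1.le
  · intro h1; exact lt_of_le_of_ne (not_lt.mp h1) h

theorem sum_rep (M : Equiv.Perm V) (hM : FPF M) (h : V → ℝ) :
    ∑ v ∈ Finset.univ.filter (rep M), (h v + h (M v)) = ∑ v, h v := by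
  rw [Finset.sum_add_distrib, ← Finset.sum_filter_add_sum_filter_not Finset.univ (rep M) h]
  congr 1
  apply Finset.sum_equiv M
  · intro v; simp [rep_iff M hM]
  · intro v _; rfl

noncomputable def reps (M : Equiv.Perm V) : List V := (Finset.univ.filter (rep M)).toList

theorem reps_length (M : Equiv.Perm V) (hM : FPF M) :
    2 * (reps M).length = Fintype.card V := by
  have := sum_rep M hM (fun _ => 1)
  simp [Finset.sum_const] at this
  simp only [reps, Finset.length_toList]
  have h2 : (((2 * (Finset.univ.filter (rep M)).card : ℕ)) : ℝ) = Fintype.card V := by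
    push_cast; linarith
  exact_mod_cast h2

theorem sum_gg (u : V → Bool) (M : Equiv.Perm V) (hM : FPF M) :
    ((reps M).map (gg u M)).sum = 3 * ∑ v, ind (u v) + (DD u M : ℝ) / 2 := by
  have h1 := sum_rep M hM (fun v => ind (u v))
  have h2 := sum_rep M hM (fun v => if u v = u (M v) then (0:ℝ) else 1)
  have h3 : ∑ v, (if u v = u (M v) then (0:ℝ) else 1) = DD u M := by
    unfold DD
    rw [Finset.card_filter]
    push_cast
    apply Finset.sum_congr rfl
    intro v _
    by_cases h : u v = u (M v) <;> simp [h]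
  rw [h3] at h2
  have h4 : ∀ v, (if u v = u (M v) then (0:ℝ) else 1) +
      (if u (M v) = u (M (M v)) then (0:ℝ) else 1) = 2 * (if u v = u (M v) then (0:ℝ) else 1) := by
    intro v
    rw [(hM v).1]
    by_cases h : u v = u (M v)
    · simp [h]
    · simp [h, Ne.symm h]; norm_num
  simp only [h4, ← Finset.mul_sum] at h2
  simp only [reps, Finset.sum_map_toList]
  unfold gg
  simp only [Finset.sum_add_distrib, ← Finset.mul_sum] at h1 ⊢
  linarith

noncomputable def tlist (M : Equiv.Perm V) : List (XX V r) :=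
  ((List.finRange r).map Fin.succ).map Sum.inr ++ (Sum.inl (Sum.inr false, 0) ::
    Sum.inl (Sum.inr false, 1) :: Sum.inl (Sum.inr false, 2) ::
    ((reps M).flatMap (blk M) ++ [Sum.inl (Sum.inr true, 2), Sum.inl (Sum.inr true, 1),
      Sum.inl (Sum.inr true, 0)]))

theorem ps_tlist (u : V → Bool) (M : Equiv.Perm V) (hM : FPF M) :
    ps (WT (r := r) u) (Sum.inr 0) (tlist M ++ [Sum.inr 0]) =
      3 * (∑ v, ind (u v) + 2) + (DD u M : ℝ) / 2 := by
  have e : tlist M ++ [Sum.inr 0] = ((List.finRange r).map Fin.succ).map Sum.inr ++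
    (Sum.inl (Sum.inr false, 0) ::
    Sum.inl (Sum.inr false, 1) :: Sum.inl (Sum.inr false, 2) ::
    ((reps M).flatMap (blk M) ++ endl) : List (XX V r)) := by
    simp [tlist, endl]
  rw [e, ps_D]
  simp only [ps]
  rw [ps_blocks u M hM (rep M) (fun v hv => by rw [rep_iff M hM]; exact not_not.mpr hv) (reps M)
    (fun v hv => by simpa [reps] using hv) _ (fun v _ => by simp) (by simp), sum_gg u M hM,
    WT_same, WT_same]
  simp [up, ind]
  ring

theorem mem_tlist (M : Equiv.Perm V) (hM : FPF M) (x : XX V r) :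
    x ∈ (Sum.inr 0 :: tlist M : List (XX V r)) := by
  rcases x with ⟨(v | b), j⟩ | d
  · have hj : j = 0 ∨ j = 1 ∨ j = 2 := by revert j; decide
    simp only [tlist, List.mem_cons, List.mem_append, List.mem_flatMap]
    right; right; right; right; right; left
    by_cases h : rep M v
    · refine ⟨v, by simpa [reps] using h, ?_⟩
      rcases hj with rfl | rfl | rfl <;> simp [blk]
    · refine ⟨M v, by simpa [reps, rep_iff M hM] using h, ?_⟩
      rcases hj with rfl | rfl | rfl <;> simp [blk, (hM v).1]
  · have hj : j = 0 ∨ j = 1 ∨ j = 2 := by revert j; decide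
    cases b <;> rcases hj with rfl | rfl | rfl <;> simp [tlist]
  · refine Fin.cases ?_ (fun i => ?_) d
    · simp
    · simp [tlist]

theorem nodup_tlist (M : Equiv.Perm V) (hM : FPF M) :
    (Sum.inr 0 :: tlist M : List (XX V r)).Nodup := by
  rw [← Multiset.coe_nodup, ← Multiset.toFinset_card_eq_card_iff_nodup]
  have h : (((Sum.inr 0 :: tlist M : List (XX V r)) : Multiset (XX V r))).toFinset
      = Finset.univ := by
    ext x; simpa using mem_tlist M hM x
  rw [h, Finset.card_univ]
  have := reps_length M hM
  have h2 : ((reps M).flatMap (blk (r := r) M)).length = 6 * (reps M).length := by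
    rw [List.length_flatMap]
    simp [blk]
    ring
  simp only [Multiset.coe_card, List.length_cons, tlist, List.length_append, List.length_map,
    List.length_finRange, h2]
  simp
  omega

theorem exists_tour_M {n : ℕ} (hn : 3 ≤ n) (e : XX V r ≃ Fin n) (M : Equiv.Perm V) (hM : FPF M) :
    ∃ x ∈ tspPolytope n, ∀ u : V → Bool,
      cutSum ((hand u).map e.toEmbedding) x +
        ∑ v ∈ Finset.univ.filter (fun v => up u v = true),
          cutSum ((tooth v).map e.toEmbedding) x =
      3 * (∑ v, ind (u v) + 2) + (DD u M : ℝ) / 2 := by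
  obtain ⟨x, hx, h⟩ := exists_tour hn e (Sum.inr 0) (tlist M) (nodup_tlist M hM) (mem_tlist M hM)
  refine ⟨x, hx, fun u => ?_⟩
  rw [← ps_tlist (r := r) u M hM]
  simp only [h]
  rw [← ps_sum, ← ps_add]
  rfl

noncomputable def teeth {n : ℕ} (e : XX V r ≃ Fin n) (u : V → Bool)
    (i : Fin (Fintype.card {v // up u v = true})) : Finset (Fin n) :=
  (tooth ((Fintype.equivFin {v // up u v = true}).symm i).1).map e.toEmbedding

theorem sum_teeth {n : ℕ} (e : XX V r ≃ Fin n) (u : V → Bool) (F : Finset (Fin n) → ℝ) :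
    ∑ i, F (teeth e u i) = ∑ v ∈ Finset.univ.filter (fun v => up u v = true),
      F ((tooth v).map e.toEmbedding) := by
  rw [Finset.sum_subtype (p := fun v => up u v = true) _ (by simp)]
  exact Fintype.sum_equiv (Fintype.equivFin {v // up u v = true}).symm _ _ (fun i => rfl)

theorem card_up (u : V → Bool) : Fintype.card {v // up u v = true} =
    (∑ v, if u v = true then 1 else 0) + 2 := by
  rw [Fintype.card_subtype, Finset.card_filter, Fintype.sum_sum_type]
  congr 1

theorem uniform_comb {n : ℕ} (inst : DecidableEq (Fin n)) (e : XX V r ≃ Fin n) (u : V → Bool)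
    (hu : OddU u) :
    IsUniformComb 1 3 ((hand u).map e.toEmbedding) (teeth e u) := by
  have hk := card_up u
  have hint : ∀ i, (hand u).map e.toEmbedding ∩ teeth e u i =
      {e (Sum.inl (((Fintype.equivFin {v // up u v = true}).symm i).1, 0))} := by
    intro i
    ext y
    obtain ⟨x, rfl⟩ := e.surjective y
    have h := ((Fintype.equivFin {v // up u v = true}).symm i).2
    rcases x with ⟨v, j⟩ | d
    · simp [teeth, mem_hand_inl, mem_tooth_inl]
      constructor
      · rintro ⟨⟨h1, h2⟩, h3⟩; exact ⟨h3, h2⟩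
      · rintro ⟨h3, h2⟩; exact ⟨⟨h3 ▸ h, h2⟩, h3⟩
    · simp [teeth, mem_tooth_inr]
  refine ⟨⟨?_, ?_, ?_, ?_, ?_⟩, ?_⟩
  · rw [hk]
    obtain ⟨t, ht⟩ := hu
    omega
  · rw [hk]
    exact Odd.add_even hu even_two
  · intro i j hij
    rw [Finset.disjoint_left]
    intro y hy hy2
    obtain ⟨x, rfl⟩ := e.surjective y
    rcases x with ⟨v, l⟩ | d
    · simp [teeth, mem_tooth_inl] at hy hy2
      apply hij
      rw [hy] at hy2
      exact (Fintype.equivFin {v // up u v = true}).symm.injective (Subtype.ext hy2)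
    · simp [teeth, mem_tooth_inr] at hy
  · intro i
    rw [hint]; simp
  · refine ⟨e (Sum.inr 0), ?_⟩
    simp [teeth, mem_tooth_inr, mem_hand_inr]
  · intro i
    rw [hint]
    refine ⟨?_, by simp⟩
    rw [teeth, Finset.card_map]
    have : (tooth ((Fintype.equivFin {v // up u v = true}).symm i).1 : Finset (XX V r)) =
      (Finset.univ : Finset (Fin 3)).map
        ⟨fun j => Sum.inl (((Fintype.equivFin {v // up u v = true}).symm i).1, j),
          fun a b h => by simpa using h⟩ := by
      ext x
      simp only [tooth, Finset.mem_filter, Finset.mem_univ, true_and, Finset.mem_map]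
      exact exists_congr (fun j => eq_comm)
    rw [this]; simp

end comb


section yann

noncomputable def cutL {n : ℕ} (S : Finset (Fin n)) : (KEdge n → ℝ) →ₗ[ℝ] ℝ where
  toFun := cutSum S
  map_add' x y := by simp [cutSum, Finset.sum_add_distrib]
  map_smul' c x := by simp [cutSum, Finset.mul_sum]

theorem xc_spec {ι : Type*} [Fintype ι] (P : Set (ι → ℝ)) (hP : IsPolyhedron P) :
    ∃ (m : ℕ) (A : Matrix (Fin (xc P)) (Fin m) ℝ) (b : Fin (xc P) → ℝ)
      (π : (Fin m → ℝ) →ₗ[ℝ] (ι → ℝ)), π '' {x | A.mulVec x ≤ b} = P := by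
  have hne : {k | ∃ (m : ℕ) (A : Matrix (Fin k) (Fin m) ℝ) (b : Fin k → ℝ)
      (π : (Fin m → ℝ) →ₗ[ℝ] (ι → ℝ)),
      π '' {x | A.mulVec x ≤ b} = P}.Nonempty := by
    obtain ⟨k, A, b, rfl⟩ := hP
    let ε := Fintype.equivFin ι
    refine ⟨k, Fintype.card ι, fun i j => A i (ε.symm j), b, LinearMap.funLeft ℝ ℝ ε, ?_⟩
    have key : ∀ (z : Fin (Fintype.card ι) → ℝ) i,
        Matrix.mulVec (fun i j => A i (ε.symm j)) z i = ∑ j, A i j * z (ε j) := by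
      intro z i
      simp only [Matrix.mulVec, dotProduct]
      exact Fintype.sum_equiv ε.symm _ _ (fun j => by simp)
    ext x
    constructor
    · rintro ⟨z, hz, rfl⟩ i
      have := hz i
      rw [key] at this
      exact this
    · intro hx
      refine ⟨x ∘ ε.symm, ?_, ?_⟩
      · intro i
        rw [key]
        simpa using hx i
      · funext j
        simp [LinearMap.funLeft_apply]
  exact Nat.sInf_mem hne

theorem main_bound {m r n : ℕ} (hn : 3 ≤ n) (e : XX (TV m) r ≃ Fin n)
    (Q : Set (KEdge n → ℝ)) (hQ : IsPolyhedron Q) (hsub : tspPolytope n ⊆ Q)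
    (hcomb : ∀ x ∈ Q, ∀ (H : Finset (Fin n)) (k : ℕ) (T : Fin k → Finset (Fin n)),
          IsUniformComb 1 3 H T →
            (3 * k + 1 : ℝ) ≤ cutSum H x + ∑ i, cutSum (T i) x) :
    (0.196 : ℝ) ≤ ((xc Q : ℝ) + 1) * (6 * m + 10) * 8 * Real.exp (-0.000001 * (m+1)) := by
  obtain ⟨d, A, b, π, hπ⟩ := xc_spec Q hQ
  let k := xc Q
  have hk : k = xc Q := rfl
  -- tours
  have htour : ∀ M : Equiv.Perm (TV m), ∃ z : Fin d → ℝ, FPF M → (A.mulVec z ≤ b ∧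
      ∀ u : TV m → Bool,
      cutSum ((hand u).map e.toEmbedding) (π z) +
        ∑ i, cutSum (teeth e u i) (π z) =
      3 * (∑ v, ind (u v) + 2) + (DD u M : ℝ) / 2) := by
    intro M
    by_cases hM : FPF M
    · obtain ⟨x, hx, h⟩ := exists_tour_M hn e M hM
      have hxQ := hsub hx
      rw [← hπ] at hxQ
      obtain ⟨z, hz, rfl⟩ := hxQ
      refine ⟨z, fun _ => ⟨hz, fun u => ?_⟩⟩
      rw [sum_teeth e u (fun S => cutSum S (π z))]
      exact h u
    · exact ⟨0, fun h => absurd h hM⟩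
  choose zz hzz using htour
  have hcard : ∀ u : TV m → Bool,
      ((Fintype.card {v // up u v = true} : ℕ) : ℝ) = ∑ v, ind (u v) + 2 := by
    intro u
    rw [card_up]
    push_cast
    rfl
  have hfar : ∀ u : TV m → Bool, ∃ (c : Fin k → ℝ) (c0 : ℝ), OddU u →
      ((∀ i, 0 ≤ c i) ∧ 0 ≤ c0 ∧ ∀ z : Fin d → ℝ,
        cutSum ((hand u).map e.toEmbedding) (π z) + ∑ i, cutSum (teeth e u i) (π z)
          - (3 * (∑ v, ind (u v) + 2) + 1) =
        ∑ i, c i * (b i - A.mulVec z i) + c0) := by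
    intro u
    by_cases hu : OddU u
    · let M0 : Equiv.Perm (TV m) := MM (fun _ => true)
      have hM0 : FPF M0 := by
        have := FPF_MM (m := m) (fun _ => true) 1
        simpa using this
      obtain ⟨c, c0, h1, h2, h3⟩ := farkas_affine k
        (fun i => (LinearMap.proj i).comp A.mulVecLin) b
        (-((cutL ((hand u).map e.toEmbedding) + ∑ i, cutL (teeth e u i)).comp π))
        (-(3 * (∑ v, ind (u v) + 2) + 1))
        ⟨zz M0, fun i => (hzz M0 hM0).1 i⟩
        (by
          intro z hz
          have hzQ : π z ∈ Q := by
            rw [← hπ]; exact ⟨z, fun i => hz i, rfl⟩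
          have := hcomb (π z) hzQ _ _ _ (uniform_comb _ e u hu)
          rw [hcard] at this
          simp only [LinearMap.neg_apply, LinearMap.comp_apply, LinearMap.add_apply,
            LinearMap.sum_apply]
          exact neg_le_neg this)
      refine ⟨c, c0, fun _ => ⟨h1, h2, fun z => ?_⟩⟩
      have := h3 z
      simp only [LinearMap.neg_apply, LinearMap.comp_apply, LinearMap.add_apply,
            LinearMap.sum_apply] at this
      refine Eq.trans ?_ this
      change _ = -(3 * (∑ v, ind (u v) + 2) + 1) -
        -(cutSum ((hand u).map e.toEmbedding) (π z) + ∑ i, cutSum (teeth e u i) (π z))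
      ring
    · exact ⟨0, 0, fun h => absurd h hu⟩
  choose c c0 hc using hfar
  have key := rank_bound (m := m) (ι := Option (Fin k))
    (fun o u => match o with
      | none => c0 u
      | some i => c u i)
    (fun o M => match o with
      | none => 1
      | some i => b i - A.mulVec (zz M) i)
    (by
      rintro (_ | i) u hu
      · exact (hc u hu).2.1
      · exact (hc u hu).1 i)
    (by
      rintro (_ | i) M hM
      · exact zero_le_one
      · exact sub_nonneg.mpr ((hzz M hM).1 i))
    (by
      intro u M hu hM
      have h1 := (hc u hu).2.2 (zz M)
      rw [(hzz M hM).2 u] at h1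
      rw [Fintype.sum_option]
      simp only
      linarith)
  simpa [hk] using key

end yann

theorem numeric (n m : ℕ) (K : ℝ) (hn : 10 ^ 18 ≤ n) (hm : n ≤ 18 * m + 54) (hm2 : 18 * m + 37 ≤ n)
    (h : (0.196 : ℝ) ≤ (K + 1) * (6 * m + 10) * 8 * Real.exp (-0.000001 * (m+1))) :
    (2 : ℝ) ^ ((0.00000001 : ℝ) * n) ≤ K := by
  have hn' : (1000000000000000000:ℝ) ≤ n := by exact_mod_cast hn
  have hm' : (n:ℝ) ≤ 18 * m + 54 := by exact_mod_cast hm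
  have hm2' : (18:ℝ) * m + 37 ≤ n := by exact_mod_cast hm2
  have hm0 : (0:ℝ) ≤ m := by positivity
  set t : ℝ := 0.00000001 * n with ht
  have h2 : (2:ℝ) ^ t ≤ Real.exp t := by
    rw [← Real.exp_one_rpow t]
    apply Real.rpow_le_rpow (by norm_num) _ (by positivity)
    have := Real.add_one_le_exp 1
    linarith
  refine h2.trans ?_
  have e0 := Real.exp_pos t
  have e1 : (1:ℝ) ≤ Real.exp t := Real.one_le_exp (by positivity)
  have h3 : Real.exp (5 * t) ≤ Real.exp (0.000001 * (m+1)) := by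
    apply Real.exp_le_exp.mpr
    rw [ht]; linarith
  have h4 : Real.exp (5 * t) = Real.exp t * Real.exp (4 * t) := by
    rw [← Real.exp_add]; ring_nf
  have h5 : 82 * (n:ℝ) ≤ Real.exp (4 * t) := by
    have := Real.quadratic_le_exp_of_nonneg (x := 4 * t) (by positivity)
    refine le_trans ?_ this
    rw [ht]
    nlinarith [mul_le_mul_of_nonneg_right hn' (Nat.cast_nonneg (α := ℝ) n)]
  have h6 : 0.196 * Real.exp (0.000001 * (m+1)) ≤ (K + 1) * (6 * m + 10) * 8 := by
    have := mul_le_mul_of_nonneg_right h (Real.exp_pos (0.000001 * ((m:ℝ)+1))).le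
    rwa [mul_assoc _ (Real.exp _) (Real.exp _), ← Real.exp_add,
      show (-0.000001 * ((m:ℝ)+1) + 0.000001 * (m+1)) = 0 by ring, Real.exp_zero, mul_one] at this
  by_contra hK
  push Not at hK
  have h7 : (K + 1) * (6 * m + 10) * 8 ≤ (2 * Real.exp t) * n * 8 := by
    have : K + 1 ≤ 2 * Real.exp t := by linarith
    gcongr
    linarith
  have h8 : Real.exp t * (82 * n) ≤ Real.exp t * Real.exp (4 * t) :=
    mul_le_mul_of_nonneg_left h5 e0.le
  have h9 : 0 < Real.exp t * n := by positivity
  nlinarith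

theorem hfree_tsp_xc_stmt3 :
    ∃ c : ℝ, 0 < c ∧ ∃ N : ℕ, ∀ n : ℕ, 3 ∣ n → N ≤ n →
      ∀ Q : Set (KEdge n → ℝ), IsPolyhedron Q → tspPolytope n ⊆ Q →
        (∀ x ∈ Q, ∀ (H : Finset (Fin n)) (k : ℕ) (T : Fin k → Finset (Fin n)),
          IsUniformComb 1 3 H T →
            (3 * k + 1 : ℝ) ≤ cutSum H x + ∑ i, cutSum (T i) x) →
        (2 : ℝ) ^ (c * n) ≤ (xc Q : ℝ) := by
  refine ⟨0.00000001, by norm_num, 10 ^ 18, ?_⟩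
  intro n _ hn Q hQ hsub hcomb
  have hn1 : 1000 ≤ n := le_trans (by norm_num) hn
  obtain ⟨m, hm⟩ : ∃ m, m = (n - 37) / 18 := ⟨_, rfl⟩
  obtain ⟨r, hr⟩ : ∃ r, r = n - 18 * m - 37 := ⟨_, rfl⟩
  have hcard : Fintype.card (XX (TV m) r) = n := by
    have : Fintype.card (XX (TV m) r) = (6 * m + 10 + 2) * 3 + (r + 1) := by
      simp [Fintype.card_sum, Fintype.card_prod]; ring
    omega
  have key := main_bound (by omega) (Fintype.equivFinOfCardEq hcard) Q hQ hsub hcomb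
  exact numeric n m (xc Q) hn (by omega) (by omega) key
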